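/- Let τ = ℕ and let t : ℕ be a System T term whose only free variable is α : ℕ → ℕ. Then the functional Φ^t(⟦B_{t°}⟧) satisfies Spector's bar-recursion equation for Y = fun α => ⟦t⟧(α). Moreover, if t lies in the fragment T_i then Φ^t(B_{t°}) is definable by a closed term of the fragment T_j, where j = 2 + max(1, level σ) + i. (Corollary 3.4.) -/

import Mathlib

/-- Extension of a finite sequence `s` by infinitely many copies of `z` (the "hat"). -/
def ext {τ : Type*} (z : τ) (s : List τ) : ℕ → τ := fun n => s.getD n z

/-- Concatenation `s * β` of a finite sequence with an infinite one. -/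
def cat {τ : Type*} (s : List τ) (β : ℕ → τ) : ℕ → τ :=
  fun n => if h : n < s.length then s[n] else β (n - s.length)

/-- `S` is a bar: decidable, monotone, and hit by every infinite sequence. -/
def IsBar {τ : Type*} (S : List τ → Prop) : Prop :=
  (∀ s, S s ∨ ¬ S s) ∧ (∀ s t : List τ, S s → S (s ++ t)) ∧
    (∀ α : ℕ → τ, ∃ n : ℕ, S ((List.range n).map α))

/-- `S` secures `Y`: whenever `S s` holds, `fun β => Y (s * β)` is constant. -/
def Secures {τ : Type*} (S : List τ → Prop) (Y : (ℕ → τ) → ℕ) : Prop :=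
  ∀ s, S s → ∀ β β' : ℕ → τ, Y (cat s β) = Y (cat s β')

/-- The general bar-recursion equation for the bar `S`. -/
def GenBR {τ σ : Type*} (S : List τ → Prop)
    (Δ : (List τ → σ) → (List τ → (τ → σ) → σ) → List τ → σ) : Prop :=
  ∀ G H s, (S s → Δ G H s = G s) ∧
    (¬ S s → Δ G H s = H s (fun x => Δ G H (s ++ [x])))

/-- Spector's bar-recursion equation for the stopping functional `Y`. -/
def SpectorBR {τ σ : Type*} (z : τ) (Y : (ℕ → τ) → ℕ)
    (ξ : (List τ → σ) → (List τ → (τ → σ) → σ) → List τ → σ) : Prop :=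
  ∀ G H s, (Y (ext z s) < s.length → ξ G H s = G s) ∧
    (s.length ≤ Y (ext z s) → ξ G H s = H s (fun x => ξ G H (s ++ [x])))

/-- The auxiliary functional `φ`. -/
def phi {τ σ : Type*} (G : List τ → σ) (H : List τ → (τ → σ) → σ) : ℕ → List τ → σ
  | 0 => G
  | n + 1 => fun s => H s (fun x => phi G H n (s ++ [x]))

/-- The functional `Ψ`, bar recursion for a constant stopping functional. -/
def psi {τ σ : Type*} (k : ℕ) (G : List τ → σ) (H : List τ → (τ → σ) → σ)
    (s : List τ) : σ :=
  if s.length > k then G s else phi G H (k + 1 - s.length) s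

/-- Simple finite types, built only from `ℕ` and `→`. -/
inductive Ty where
  | nat : Ty
  | arr : Ty → Ty → Ty

/-- Set-theoretic semantics of simple types. -/
def Ty.sem : Ty → Type
  | .nat => ℕ
  | .arr a b => a.sem → b.sem

/-- Typed de Bruijn indices into a context. -/
inductive Idx {κ : Type} : List κ → κ → Type where
  | zero {Γ ρ} : Idx (ρ :: Γ) ρ
  | succ {Γ ρ η} : Idx Γ ρ → Idx (η :: Γ) ρ

/-- Semantic environments for a context. -/
def Env {κ : Type} (f : κ → Type*) : List κ → Type _
  | [] => PUnit
  | ρ :: Γ => f ρ × Env f Γ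

/-- Looking up a variable in an environment. -/
def Idx.lookup {κ : Type} {f : κ → Type*} : ∀ {Γ : List κ} {ρ : κ}, Idx Γ ρ → Env f Γ → f ρ
  | _, _, .zero, e => e.1
  | _, _, .succ v, e => v.lookup e.2

/-- Terms of Gödel's System T over the simple types, in a context `Γ`, with a
distinguished variable (constant) `alpha : ℕ → τv`, the constants `0`, `Succ`,
and the recursors `Rec^ℕ` and `Rec^{ρ → ℕ}` of the paper. -/
inductive Tm (τv : Ty) : List Ty → Ty → Type where
  | var {Γ ρ} : Idx Γ ρ → Tm τv Γ ρ
  | lam {Γ a b} : Tm τv (a :: Γ) b → Tm τv Γ (.arr a b)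
  | app {Γ a b} : Tm τv Γ (.arr a b) → Tm τv Γ a → Tm τv Γ b
  | zero {Γ} : Tm τv Γ .nat
  | succ {Γ} : Tm τv Γ (.arr .nat .nat)
  | alpha {Γ} : Tm τv Γ (.arr .nat τv)
  | recN {Γ} : Tm τv Γ (.arr .nat (.arr (.arr .nat (.arr .nat .nat)) (.arr .nat .nat)))
  | recA {Γ} (ρ : Ty) : Tm τv Γ (.arr (.arr ρ .nat)
      (.arr (.arr .nat (.arr (.arr ρ .nat) (.arr ρ .nat))) (.arr .nat (.arr ρ .nat))))

/-- Standard set-theoretic semantics of terms, parametrized by the value of `alpha`. -/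
def Tm.sem {τv : Ty} : ∀ {Γ ρ}, Tm τv Γ ρ → (ℕ → τv.sem) → Env Ty.sem Γ → ρ.sem
  | _, _, .var v, _, e => v.lookup e
  | _, _, .lam t, α, e => fun x => t.sem α (x, e)
  | _, _, .app u v, α, e => u.sem α e (v.sem α e)
  | _, _, .zero, _, _ => (0 : ℕ)
  | _, _, .succ, _, _ => Nat.succ
  | _, _, .alpha, α, _ => α
  | _, _, .recN, _, _ => fun a f n => Nat.rec (motive := fun _ => ℕ) a f n
  | _, _, .recA ρ, _, _ => fun a f n => Nat.rec (motive := fun _ => Ty.sem ρ → ℕ) a f n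

/-- Semantics of the type translation `ρ ↦ ρ°` (case `τ = ℕ`), for result type `σS`:
`ℕ°` is interpreted by `((ℕ → ℕ) → ℕ) × ((ℕ* → σ) → (ℕ* → (ℕ → σ) → σ) → ℕ* → σ)`
and `(ρ₀ → ρ₁)°` by functions. -/
def TyC (σS : Type*) : Ty → Type _
  | .nat => ((ℕ → ℕ) → ℕ) ×
      ((List ℕ → σS) → (List ℕ → (ℕ → σS) → σS) → List ℕ → σS)
  | .arr a b => TyC σS a → TyC σS b

/-- The interpretation of the numeral translation `k° = ⟨λα.k, λG H.G⟩`. -/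
def kc (σS : Type*) (k : ℕ) : TyC σS .nat := ⟨fun _ => k, fun G _ => G⟩

/-- Semantics of the term translation `t ↦ t°` (case `τ = ℕ`), following
Definition 3.1 of the paper clause by clause. -/
def Tm.csem (σS : Type*) : ∀ {Γ ρ}, Tm .nat Γ ρ → Env (TyC σS) Γ → TyC σS ρ
  | _, _, .var v, e => v.lookup e
  | _, _, .lam t, e => fun x => t.csem σS (x, e)
  | _, _, .app u v, e => u.csem σS e (v.csem σS e)
  | _, _, .zero, _ => ⟨fun _ => (0 : ℕ), fun G _ => G⟩
  | _, _, .succ, _ => fun x => ⟨fun α => Nat.succ (x.1 α), x.2⟩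
  | _, _, .alpha, _ => fun x =>
      ⟨fun α => α (x.1 α),
       fun G H => x.2 (fun s' => psi (x.1 (ext 0 s')) G H s') H⟩
  | _, _, .recN, _ => fun a F x =>
      let r : ℕ → TyC σS .nat :=
        fun n => Nat.rec (motive := fun _ => TyC σS .nat) a (fun k ih => F (kc σS k) ih) n
      ⟨fun α => (r (x.1 α)).1 α,
       fun G H s => x.2 (fun s' => (r (x.1 (ext 0 s'))).2 G H s') H s⟩
  | _, _, .recA ρ, _ => fun a F x v =>
      let r : ℕ → TyC σS (.arr ρ .nat) :=
        fun n => Nat.rec (motive := fun _ => TyC σS (.arr ρ .nat)) a (fun k ih => F (kc σS k) ih) n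
      ⟨fun α => (r (x.1 α) v).1 α,
       fun G H s => x.2 (fun s' => (r (x.1 (ext 0 s')) v).2 G H s') H s⟩


/-- The functional `H^t` (with `Y = ⟦t⟧`). -/
def Hdag {τ σ : Type*} (z : τ) (t : (ℕ → τ) → ℕ) (G : List τ → σ)
    (H : List τ → (τ → σ) → σ) (s : List τ) (f : τ → σ) : σ :=
  if t (ext z s) < s.length then G s else H s f

/-- The functional `Φ^t`. -/
def PhiT {τ σ : Type*} (z : τ) (t : (ℕ → τ) → ℕ)
    (Δ : (List τ → σ) → (List τ → (τ → σ) → σ) → List τ → σ)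
    (G : List τ → σ) (H : List τ → (τ → σ) → σ) (s : List τ) : σ :=
  Δ (fun s' => psi (t (ext z s')) G H s') (Hdag z t G H) s

/-- Full finite types: `ℕ`, function, product, and finite-sequence types. -/
inductive FinType where
  | nat : FinType
  | arr : FinType → FinType → FinType
  | prod : FinType → FinType → FinType
  | star : FinType → FinType

/-- Set-theoretic semantics of finite types. -/
def FinType.sem : FinType → Type
  | .nat => ℕ
  | .arr a b => a.sem → b.sem
  | .prod a b => a.sem × b.sem
  | .star a => List a.sem

/-- The level of a finite type. -/
def FinType.level : FinType → ℕ
  | .nat => 0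
  | .arr a b => max (1 + a.level) b.level
  | .prod a b => max a.level b.level
  | .star a => a.level

/-- The level of a simple type. -/
def Ty.level : Ty → ℕ
  | .nat => 0
  | .arr a b => max (1 + a.level) b.level

/-- `t` lies in the fragment `T_i`: every recursor `Rec^η` occurring in `t` has
`level η ≤ i` (the recursor `Rec^ℕ` has level `0`, and `Rec^{ρ → ℕ}` has level
`level (ρ → ℕ)`). -/
def Tm.inFrag {τv : Ty} (i : ℕ) : ∀ {Γ ρ}, Tm τv Γ ρ → Prop
  | _, _, .lam t => t.inFrag i
  | _, _, .app u v => u.inFrag i ∧ v.inFrag i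
  | _, _, .recN => (Ty.nat).level ≤ i
  | _, _, .recA ρ => (Ty.arr ρ .nat).level ≤ i
  | _, _, _ => True

/-- Terms of full System T (with products and finite-sequence types as definitional
extensions): `λ`-calculus with `0`, `Succ`, the recursor `Rec^ρ` for each finite
type `ρ`, pairing and projections, and basic finite-sequence constants. -/
inductive TmX : List FinType → FinType → Type where
  | var {Γ ρ} : Idx Γ ρ → TmX Γ ρ
  | lam {Γ a b} : TmX (a :: Γ) b → TmX Γ (.arr a b)
  | app {Γ a b} : TmX Γ (.arr a b) → TmX Γ a → TmX Γ b
  | zero {Γ} : TmX Γ .nat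
  | succ {Γ} : TmX Γ (.arr .nat .nat)
  | natrec {Γ} (ρ : FinType) :
      TmX Γ (.arr ρ (.arr (.arr .nat (.arr ρ ρ)) (.arr .nat ρ)))
  | pair {Γ} (a b : FinType) : TmX Γ (.arr a (.arr b (.prod a b)))
  | fst {Γ} (a b : FinType) : TmX Γ (.arr (.prod a b) a)
  | snd {Γ} (a b : FinType) : TmX Γ (.arr (.prod a b) b)
  | nil {Γ} (a : FinType) : TmX Γ (.star a)
  | cons {Γ} (a : FinType) : TmX Γ (.arr a (.arr (.star a) (.star a)))
  | snoc {Γ} (a : FinType) : TmX Γ (.arr (.star a) (.arr a (.star a)))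
  | len {Γ} (a : FinType) : TmX Γ (.arr (.star a) .nat)
  | getd {Γ} (a : FinType) : TmX Γ (.arr (.star a) (.arr .nat (.arr a a)))

/-- Set-theoretic semantics of full System T terms. -/
def TmX.semX : ∀ {Γ ρ}, TmX Γ ρ → Env FinType.sem Γ → ρ.sem
  | _, _, .var v, e => v.lookup e
  | _, _, .lam t, e => fun x => t.semX (x, e)
  | _, _, .app u v, e => u.semX e (v.semX e)
  | _, _, .zero, _ => (0 : ℕ)
  | _, _, .succ, _ => Nat.succ
  | _, _, .natrec ρ, _ => fun a f n => Nat.rec (motive := fun _ => ρ.sem) a f n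
  | _, _, .pair _ _, _ => fun x y => (x, y)
  | _, _, .fst _ _, _ => Prod.fst
  | _, _, .snd _ _, _ => Prod.snd
  | _, _, .nil _, _ => ([] : List _)
  | _, _, .cons _, _ => fun x s => x :: s
  | _, _, .snoc a, _ => fun s x => (show List a.sem from s) ++ [x]
  | _, _, .len _, _ => List.length
  | _, _, .getd _, _ => fun s n d => s.getD n d

/-- A full System T term lies in the fragment `T_j`: every recursor `Rec^ρ`
occurring in it has `level ρ ≤ j`. -/
def TmX.inFragX (j : ℕ) : ∀ {Γ ρ}, TmX Γ ρ → Prop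
  | _, _, .lam t => t.inFragX j
  | _, _, .app u v => u.inFragX j ∧ v.inFragX j
  | _, _, .natrec ρ => ρ.level ≤ j
  | _, _, _ => True

section Bars

variable {τ σ : Type*}

lemma cat_append (s t : List τ) (β : ℕ → τ) : cat (s ++ t) β = cat s (cat t β) := by
  funext n
  simp only [cat, List.length_append]
  split_ifs with h₁ h₂ h₃ h₄ h₅
  · exact List.getElem_append_left h₂
  · exact List.getElem_append_right (by omega)
  all_goals first | omega | (congr 1; omega)

lemma ext_eq_cat (z : τ) (s : List τ) : ext z s = cat s (fun _ => z) := by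
  funext n
  by_cases h : n < s.length <;> simp [ext, cat, List.getD, h]

lemma cat_map_range (α : ℕ → τ) (n : ℕ) :
    cat ((List.range n).map α) (fun k => α (n + k)) = α := by
  funext m
  by_cases h : m < n
  · simp [cat, h]
  · simp only [cat, List.length_map, List.length_range, h, dite_false]
    congr 1; omega

lemma map_range_add (α : ℕ → τ) (n k : ℕ) :
    ∃ t, (List.range (n + k)).map α = (List.range n).map α ++ t :=
  ⟨_, by rw [List.range_add, List.map_append]⟩

lemma IsBar.mono {S : List τ → Prop} (hS : IsBar S) {s : List τ} (h : S s) (t : List τ) :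
    S (s ++ t) := hS.2.1 s t h

lemma IsBar.hit_add {S : List τ → Prop} (hS : IsBar S) {α : ℕ → τ} {n : ℕ}
    (h : S ((List.range n).map α)) (k : ℕ) : S ((List.range (n + k)).map α) := by
  obtain ⟨t, ht⟩ := map_range_add α n k
  exact ht ▸ hS.mono h t

lemma Secures.ext_append {S : List τ → Prop} {Y : (ℕ → τ) → ℕ} (h : Secures S Y) (z : τ)
    {s : List τ} (hs : S s) (t : List τ) : Y (ext z (s ++ t)) = Y (ext z s) := by
  rw [ext_eq_cat, ext_eq_cat, cat_append]
  exact h s hs _ _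

lemma Secures.cat_eq {S : List τ → Prop} {Y : (ℕ → τ) → ℕ} (h : Secures S Y) (z : τ)
    {s : List τ} (hs : S s) (β : ℕ → τ) : Y (cat s β) = Y (ext z s) := by
  rw [ext_eq_cat]
  exact h s hs _ _

lemma Secures.ext_map_range {S : List τ → Prop} {Y : (ℕ → τ) → ℕ} (h : Secures S Y) (z : τ)
    {α : ℕ → τ} {n : ℕ} (hs : S ((List.range n).map α)) :
    Y (ext z ((List.range n).map α)) = Y α := by
  rw [← h.cat_eq z hs (fun k => α (n + k)), cat_map_range]

lemma psi_of_lt {k : ℕ} {s : List τ} (h : k < s.length) (G : List τ → σ)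
    (H : List τ → (τ → σ) → σ) : psi k G H s = G s := by
  simp [psi, h]

lemma psi_eq_phi (k : ℕ) (G : List τ → σ) (H : List τ → (τ → σ) → σ) (s : List τ) :
    psi k G H s = phi G H (k + 1 - s.length) s := by
  by_cases h : k < s.length
  · rw [psi_of_lt h, Nat.sub_eq_zero_of_le h]; rfl
  · simp [psi, h]

lemma psi_of_le {k : ℕ} {s : List τ} (h : s.length ≤ k) (G : List τ → σ)
    (H : List τ → (τ → σ) → σ) :
    psi k G H s = H s (fun x => psi k G H (s ++ [x])) := by
  simp only [psi_eq_phi, List.length_append, List.length_singleton]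
  rw [show k + 1 - s.length = (k + 1 - (s.length + 1)) + 1 by omega]
  rfl

/-- Composition of a bar `S` securing `f` with a family of bars selected by the value of `f`. -/
lemma IsBar.bind {S : List τ → Prop} {f : (ℕ → τ) → ℕ} (z : τ) {T : ℕ → List τ → Prop}
    (hS : IsBar S) (hf : Secures S f) (hT : ∀ k, IsBar (T k)) :
    IsBar (fun s => S s ∧ T (f (ext z s)) s) := by
  refine ⟨fun s => Classical.em _, ?_, ?_⟩
  · rintro s t ⟨h₁, h₂⟩
    refine ⟨hS.mono h₁ t, ?_⟩
    rw [hf.ext_append z h₁]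
    exact (hT _).mono h₂ t
  · intro α
    obtain ⟨n, hn⟩ := hS.2.2 α
    obtain ⟨m, hm⟩ := (hT (f α)).2.2 α
    have hSn := hS.hit_add hn m
    refine ⟨n + m, hSn, ?_⟩
    rw [hf.ext_map_range z hSn, add_comm]
    exact (hT _).hit_add hm n

lemma GenBR.bind {S : List τ → Prop} {f : (ℕ → τ) → ℕ} (z : τ) {T : ℕ → List τ → Prop}
    {Δ : (List τ → σ) → (List τ → (τ → σ) → σ) → List τ → σ}
    {E : ℕ → (List τ → σ) → (List τ → (τ → σ) → σ) → List τ → σ}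
    (hS : IsBar S) (hf : Secures S f) (hΔ : GenBR S Δ) (hE : ∀ k, GenBR (T k) (E k)) :
    GenBR (fun s => S s ∧ T (f (ext z s)) s)
      (fun G H => Δ (fun s' => E (f (ext z s')) G H s') H) := by
  intro G H s
  refine ⟨fun h => ?_, fun h => ?_⟩
  · simp only [(hΔ _ H s).1 h.1]
    exact (hE _ G H s).1 h.2
  · by_cases hs : S s
    · simp only [(hΔ _ H s).1 hs]
      rw [(hE _ G H s).2 fun hT => h ⟨hs, hT⟩]
      congr 1; funext x
      rw [(hΔ _ H _).1 (hS.mono hs [x]), hf.ext_append z hs]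
    · exact (hΔ _ H s).2 hs

lemma isBar_length (k : ℕ) : IsBar (fun s : List τ => k < s.length) := by
  refine ⟨fun s => Classical.em _, fun s t h => ?_, fun α => ⟨k + 1, by simp⟩⟩
  simp only [List.length_append]; omega

lemma genBR_psi (k : ℕ) : GenBR (fun s : List τ => k < s.length) (psi (σ := σ) k) :=
  fun G H _ => ⟨fun h => psi_of_lt h G H, fun h => psi_of_le (not_lt.1 h) G H⟩

/-- If `Δ` is bar recursion for some bar securing `Y`, then `PhiT z Y Δ` is Spector's bar
recursion for `Y`. -/
lemma GenBR.spectorBR {S : List τ → Prop} {Y : (ℕ → τ) → ℕ} (z : τ)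
    {Δ : (List τ → σ) → (List τ → (τ → σ) → σ) → List τ → σ}
    (hS : IsBar S) (hY : Secures S Y) (hΔ : GenBR S Δ) : SpectorBR z Y (PhiT z Y Δ) := by
  intro G H s
  simp only [PhiT]
  by_cases hs : S s
  · rw [(hΔ _ _ s).1 hs]
    refine ⟨fun h => psi_of_lt h G H, fun h => ?_⟩
    rw [psi_of_le h]
    congr 1; funext x
    rw [(hΔ _ _ _).1 (hS.mono hs [x]), hY.ext_append z hs]
  · rw [(hΔ _ _ s).2 hs]
    exact ⟨fun h => by simp [Hdag, h], fun h => by simp [Hdag, not_lt.2 h]⟩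

end Bars

section Correctness

/-- Logical relation between `α`-dependent values and the interpretation of the translation:
at type `ℕ`, the first component is the value as a function of `α`, and the second component
is bar recursion for a bar securing it. -/
def BarRel (σS : Type*) : ∀ ρ : Ty, ((ℕ → ℕ) → ρ.sem) → TyC σS ρ → Prop
  | .nat, f, x => x.1 = f ∧ ∃ S : List ℕ → Prop, IsBar S ∧ Secures S x.1 ∧ GenBR S x.2
  | .arr a b, f, g => ∀ u v, BarRel σS a u v → BarRel σS b (fun α => f α (u α)) (g v)

/-- `BarRel` extended to environments. -/
def BarRelEnv (σS : Type*) : ∀ Γ : List Ty, ((ℕ → ℕ) → Env Ty.sem Γ) → Env (TyC σS) Γ → Prop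
  | [], _, _ => True
  | ρ :: Γ, e, e' => BarRel σS ρ (fun α => (e α).1) e'.1 ∧ BarRelEnv σS Γ (fun α => (e α).2) e'.2

variable {σS : Type*}

lemma BarRelEnv.lookup : ∀ {Γ : List Ty} {ρ : Ty} (v : Idx Γ ρ) {e : (ℕ → ℕ) → Env Ty.sem Γ}
    {e' : Env (TyC σS) Γ}, BarRelEnv σS Γ e e' →
    BarRel σS ρ (fun α => v.lookup (e α)) (v.lookup e')
  | _, _, .zero, _, _, h => h.1
  | _, _, .succ v, _, _, h => BarRelEnv.lookup v h.2

lemma barRel_kc (k : ℕ) : BarRel σS .nat (fun _ => k) (kc σS k) :=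
  ⟨rfl, fun _ => True, ⟨fun _ => .inl trivial, fun _ _ _ => trivial, fun _ => ⟨0, trivial⟩⟩,
    fun _ _ _ _ => rfl, fun _ _ _ => ⟨fun _ => rfl, fun h => (h trivial).elim⟩⟩

lemma BarRel.bind {f : (ℕ → ℕ) → ℕ} {x : TyC σS .nat} {g : ℕ → (ℕ → ℕ) → ℕ}
    {r : ℕ → TyC σS .nat} (hx : BarRel σS .nat f x) (hr : ∀ k, BarRel σS .nat (g k) (r k)) :
    BarRel σS .nat (fun α => g (f α) α)
      ⟨fun α => (r (x.1 α)).1 α,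
        fun G H s => x.2 (fun s' => (r (x.1 (ext 0 s'))).2 G H s') H s⟩ := by
  obtain ⟨rfl, S, hS, hf, hΔ⟩ := hx
  choose hg T hT hTf hTΔ using hr
  refine ⟨by funext α; simp only [hg], _, hS.bind 0 hf hT, ?_, GenBR.bind 0 hS hf hΔ hTΔ⟩
  rintro s ⟨h₁, h₂⟩ β β'
  simp only [hf.cat_eq 0 h₁]
  exact hTf _ s h₂ β β'

lemma BarRel.alpha {f : (ℕ → ℕ) → ℕ} {x : TyC σS .nat} (hx : BarRel σS .nat f x) :
    BarRel σS .nat (fun α => α (f α))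
      ⟨fun α => α (x.1 α),
        fun G H => x.2 (fun s' => psi (x.1 (ext 0 s')) G H s') H⟩ := by
  refine hx.bind (g := fun k α => α k) (r := fun k => ⟨fun α => α k, psi k⟩) fun k =>
    ⟨rfl, _, isBar_length k, ?_, genBR_psi k⟩
  intro s h β β'
  simp [cat, h]

lemma BarRel.natRec {ρ : Ty} {a : (ℕ → ℕ) → ρ.sem} {a' : TyC σS ρ}
    {F : (ℕ → ℕ) → (Ty.arr .nat (.arr ρ ρ)).sem} {F' : TyC σS (.arr .nat (.arr ρ ρ))}
    (ha : BarRel σS ρ a a') (hF : BarRel σS _ F F') (k : ℕ) :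
    BarRel σS ρ (fun α => Nat.rec (motive := fun _ => ρ.sem) (a α) (F α) k)
      (Nat.rec (motive := fun _ => TyC σS ρ) a' (fun k ih => F' (kc σS k) ih) k) := by
  induction k with
  | zero => exact ha
  | succ k ih => exact hF _ _ (barRel_kc k) _ _ ih

/-- The fundamental lemma of the logical relation `BarRel`. -/
theorem barRel_csem : ∀ {Γ : List Ty} {ρ : Ty} (t : Tm .nat Γ ρ) {e : (ℕ → ℕ) → Env Ty.sem Γ}
    {e' : Env (TyC σS) Γ}, BarRelEnv σS Γ e e' →
    BarRel σS ρ (fun α => t.sem α (e α)) (t.csem σS e')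
  | _, _, .var v, _, _, h => h.lookup v
  | _, _, .lam t, _, _, h => fun _ _ huv => barRel_csem t ⟨huv, h⟩
  | _, _, .app u v, _, _, h => barRel_csem u h _ _ (barRel_csem v h)
  | _, _, .zero, _, _, _ => barRel_kc 0
  | _, _, .succ, _, _, _ => by
      rintro f x ⟨rfl, S, hS, hf, hΔ⟩
      exact ⟨rfl, S, hS, fun s hs β β' => congrArg Nat.succ (hf s hs β β'), hΔ⟩
  | _, _, .alpha, _, _, _ => fun _ _ hx => hx.alpha
  | _, _, .recN, _, _, _ => fun _ _ ha _ _ hF _ _ hx => hx.bind (BarRel.natRec ha hF)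
  | _, _, .recA _, _, _, _ => fun _ _ ha _ _ hF _ _ hx v v' hv =>
      hx.bind fun k => BarRel.natRec ha hF k v v' hv

end Correctness

section Definability

namespace FinType

/-- The type `ℕ°`. -/
def natCirc (σ : FinType) : FinType :=
  .prod (.arr (.arr .nat .nat) .nat)
    (.arr (.arr (.star .nat) σ)
      (.arr (.arr (.star .nat) (.arr (.arr .nat σ) σ)) (.arr (.star .nat) σ)))

/-- The type translation `ρ ↦ ρ°`. -/
def circ (σ : FinType) : Ty → FinType
  | .nat => natCirc σ
  | .arr a b => .arr (circ σ a) (circ σ b)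

lemma level_circ_le (σ : FinType) : ∀ ρ : Ty, (circ σ ρ).level ≤ 2 + max 1 σ.level + ρ.level
  | .nat => by simp only [circ, natCirc, level, Ty.level]; omega
  | .arr a b => by
      have ha := level_circ_le σ a
      have hb := level_circ_le σ b
      simp only [circ, level, Ty.level]; omega

end FinType

open FinType

namespace TmX

variable {Γ : List FinType}

abbrev v0 {a : FinType} : TmX (a :: Γ) a := .var .zero
abbrev v1 {a b : FinType} : TmX (b :: a :: Γ) a := .var (.succ .zero)
abbrev v2 {a b c : FinType} : TmX (c :: b :: a :: Γ) a := .var (.succ (.succ .zero))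
abbrev v3 {a b c d : FinType} : TmX (d :: c :: b :: a :: Γ) a :=
  .var (.succ (.succ (.succ .zero)))
abbrev v4 {a b c d e : FinType} : TmX (e :: d :: c :: b :: a :: Γ) a :=
  .var (.succ (.succ (.succ (.succ .zero))))
abbrev v5 {a b c d e f : FinType} : TmX (f :: e :: d :: c :: b :: a :: Γ) a :=
  .var (.succ (.succ (.succ (.succ (.succ .zero)))))

abbrev ap2 {a b c : FinType} (f : TmX Γ (.arr a (.arr b c))) (x : TmX Γ a) (y : TmX Γ b) :
    TmX Γ c := .app (.app f x) y
abbrev ap3 {a b c d : FinType} (f : TmX Γ (.arr a (.arr b (.arr c d)))) (x : TmX Γ a)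
    (y : TmX Γ b) (z : TmX Γ c) : TmX Γ d := .app (ap2 f x y) z
abbrev ap4 {a b c d e : FinType} (f : TmX Γ (.arr a (.arr b (.arr c (.arr d e))))) (x : TmX Γ a)
    (y : TmX Γ b) (z : TmX Γ c) (w : TmX Γ d) : TmX Γ e := .app (ap3 f x y z) w

/-- A term for truncated subtraction. -/
def sub : TmX Γ (.arr .nat (.arr .nat .nat)) :=
  .lam (.lam (ap3 (.natrec .nat) v1
    (.lam (.lam (ap3 (.natrec .nat) .zero (.lam (.lam v1)) v0))) v0))

lemma semX_sub (e : Env FinType.sem Γ) : sub.semX e = (fun m n => m - n : ℕ → ℕ → ℕ) := by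
  refine funext fun (m : ℕ) => funext fun (n : ℕ) => ?_
  induction n with
  | zero => rfl
  | succ n ih =>
    have h : ∀ k : ℕ, Nat.rec (motive := fun _ => ℕ) 0 (fun k _ => k) k = k - 1 := by
      rintro (_ | k) <;> rfl
    exact (congrArg (Nat.rec (motive := fun _ => ℕ) 0 fun k _ => k) ih).trans (h (m - n))

/-- A term for the extension of a finite sequence of numbers by zeros. -/
def extend : TmX Γ (.arr (.star .nat) (.arr .nat .nat)) :=
  .lam (.lam (ap3 (.getd .nat) v1 v0 .zero))

/-- A term for `psi`. -/
def psiTm (σ : FinType) : TmX Γ (.arr .nat (.arr (.arr (.star .nat) σ)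
    (.arr (.arr (.star .nat) (.arr (.arr .nat σ) σ)) (.arr (.star .nat) σ)))) :=
  .lam (.lam (.lam (.lam
    (.app (ap3 (.natrec (.arr (.star .nat) σ)) v2
      (.lam (.lam (.lam (ap2 v4 v0 (.lam (.app v2 (ap2 (.snoc .nat) v1 v0)))))))
      (ap2 sub (.app .succ v3) (.app (.len .nat) v0))) v0))))

lemma semX_psiTm (σ : FinType) (e : Env FinType.sem Γ) :
    (psiTm σ).semX e = psi (τ := ℕ) (σ := σ.sem) := by
  refine funext fun (k : ℕ) => funext fun (G : List ℕ → σ.sem) =>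
    funext fun (H : List ℕ → (ℕ → σ.sem) → σ.sem) => funext fun (s : List ℕ) => ?_
  rw [psi_eq_phi]
  have key : ∀ n : ℕ, Nat.rec (motive := fun _ => List ℕ → σ.sem) G
      (fun _ p s => H s (fun x => p (s ++ [x]))) n = phi G H n := by
    intro n
    induction n with
    | zero => rfl
    | succ n ih => simp only [ih]; rfl
  rw [← key]
  exact congrArg (fun d : ℕ → ℕ → ℕ => Nat.rec (motive := fun _ => List ℕ → σ.sem) G
    (fun _ p s => H s (fun x => p (s ++ [x]))) (d (k + 1) s.length) s)
    (semX_sub (Γ := .star .nat :: .arr (.star .nat) (.arr (.arr .nat σ) σ) ::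
      .arr (.star .nat) σ :: .nat :: Γ) (s, H, G, k, e))

/-- A term for `α°`. -/
def alphaTm (σ : FinType) : TmX Γ (.arr (natCirc σ) (natCirc σ)) :=
  .lam (ap2 (.pair _ _)
    (.lam (.app v0 (.app (.app (.fst _ _) v1) v0)))
    (.lam (.lam (ap2 (.app (.snd _ _) v2)
      (.lam (ap4 (psiTm σ) (.app (.app (.fst _ _) v3) (.app extend v0)) v2 v1 v0)) v0))))

lemma semX_alphaTm (σ : FinType) (e : Env FinType.sem Γ) :
    (alphaTm σ).semX e = fun x : TyC σ.sem .nat =>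
      (⟨fun α => α (x.1 α), fun G H => x.2 (fun s' => psi (x.1 (ext 0 s')) G H s') H⟩ :
        TyC σ.sem .nat) := by
  rw [← semX_psiTm σ e]
  rfl

/-- A term for the numeral translation `k ↦ k°`. -/
def kcTm (σ : FinType) : TmX Γ (.arr .nat (natCirc σ)) :=
  .lam (ap2 (.pair _ _) (.lam v1) (.lam (.lam v1)))

/-- A term for `n ↦ r[n]`, the iteration underlying the translated recursors. -/
def iterTm (σ κ : FinType) : TmX Γ (.arr κ (.arr (.arr (natCirc σ) (.arr κ κ)) (.arr .nat κ))) :=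
  .lam (.lam (ap2 (.natrec κ) v1 (.lam (.app v1 (.app (kcTm σ) v0)))))

/-- A term for the case distinction on a number performed by the translated recursors. -/
def bindTm (σ : FinType) : TmX Γ (.arr (.arr .nat (natCirc σ)) (.arr (natCirc σ) (natCirc σ))) :=
  .lam (.lam (ap2 (.pair _ _)
    (.lam (.app (.app (.fst _ _) (.app v2 (.app (.app (.fst _ _) v1) v0))) v0))
    (.lam (.lam (.lam (ap3 (.app (.snd _ _) v3)
      (.lam (ap3 (.app (.snd _ _) (.app v5 (.app (.app (.fst _ _) v4) (.app extend v0))))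
        v3 v2 v0)) v1 v0))))))

/-- A term for `(Rec^ℕ)°`. -/
def recNTm (σ : FinType) : TmX Γ (circ σ
    (.arr .nat (.arr (.arr .nat (.arr .nat .nat)) (.arr .nat .nat)))) :=
  .lam (.lam (.lam (ap2 (bindTm σ) (ap2 (iterTm σ (natCirc σ)) v2 v1) v0)))

/-- A term for `(Rec^{ρ → ℕ})°`. -/
def recATm (σ : FinType) (ρ : Ty) : TmX Γ (circ σ (.arr (.arr ρ .nat)
    (.arr (.arr .nat (.arr (.arr ρ .nat) (.arr ρ .nat))) (.arr .nat (.arr ρ .nat))))) :=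
  .lam (.lam (.lam (.lam (ap2 (bindTm σ)
    (.lam (.app (ap3 (iterTm σ (circ σ (.arr ρ .nat))) v4 v3 v0) v1)) v1))))

/-- A term for `Hdag`, with the stopping functional as its first argument. -/
def hdagTm (σ : FinType) : TmX Γ (.arr (.arr (.arr .nat .nat) .nat) (.arr (.arr (.star .nat) σ)
    (.arr (.arr (.star .nat) (.arr (.arr .nat σ) σ))
      (.arr (.star .nat) (.arr (.arr .nat σ) σ))))) :=
  .lam (.lam (.lam (.lam (.lam (ap3 (.natrec σ) (ap2 v2 v1 v0) (.lam (.lam (.app v5 v3)))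
    (ap2 sub (.app (.len .nat) v1) (.app v4 (.app extend v1))))))))

lemma semX_hdagTm (σ : FinType) (e : Env FinType.sem Γ) :
    (hdagTm σ).semX e = Hdag (τ := ℕ) (σ := σ.sem) 0 := by
  refine funext fun (Y : (ℕ → ℕ) → ℕ) => funext fun (G : List ℕ → σ.sem) =>
    funext fun (H : List ℕ → (ℕ → σ.sem) → σ.sem) => funext fun (s : List ℕ) =>
      funext fun (f : ℕ → σ.sem) => ?_
  refine (congrArg (fun d : ℕ → ℕ → ℕ => Nat.rec (motive := fun _ => σ.sem) (H s f)
    (fun _ _ => G s) (d s.length (Y (ext 0 s)))) (semX_sub (Γ := .arr .nat σ :: .star .nat ::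
      .arr (.star .nat) (.arr (.arr .nat σ) σ) :: .arr (.star .nat) σ ::
      .arr (.arr .nat .nat) .nat :: Γ) (f, s, H, G, Y, e))).trans ?_
  rw [Hdag]
  split_ifs with h
  · obtain ⟨n, hn⟩ := Nat.exists_eq_succ_of_ne_zero (Nat.sub_ne_zero_of_lt h)
    simp only [hn]
  · rw [Nat.sub_eq_zero_of_le (not_lt.1 h)]
    rfl

/-- A term for `x ↦ PhiT 0 Val_x B_x`. -/
def phiTTm (σ : FinType) : TmX Γ (.arr (natCirc σ) (.arr (.arr (.star .nat) σ)
    (.arr (.arr (.star .nat) (.arr (.arr .nat σ) σ)) (.arr (.star .nat) σ)))) :=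
  .lam (.lam (.lam (ap2 (.app (.snd _ _) v2)
    (.lam (ap4 (psiTm σ) (.app (.app (.fst _ _) v3) (.app extend v0)) v2 v1 v0))
    (ap3 (hdagTm σ) (.app (.fst _ _) v2) v1 v0))))

lemma semX_phiTTm (σ : FinType) (e : Env FinType.sem Γ) :
    (phiTTm σ).semX e = fun x : TyC σ.sem .nat => PhiT (τ := ℕ) 0 x.1 x.2 := by
  unfold PhiT
  rw [← semX_psiTm σ e, ← semX_hdagTm σ e]
  rfl

/-- The translation of variables. -/
def circIdx (σ : FinType) : ∀ {Γ : List Ty} {ρ : Ty}, Idx Γ ρ → Idx (Γ.map (circ σ)) (circ σ ρ)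
  | _, _, .zero => .zero
  | _, _, .succ v => .succ (circIdx σ v)

/-- The term translation `t ↦ t°`. -/
def circTm (σ : FinType) : ∀ {Γ : List Ty} {ρ : Ty}, Tm .nat Γ ρ →
    TmX (Γ.map (circ σ)) (circ σ ρ)
  | _, _, .var v => .var (circIdx σ v)
  | _, _, .lam t => .lam (circTm σ t)
  | _, _, .app u v => .app (circTm σ u) (circTm σ v)
  | _, _, .zero => .app (kcTm σ) .zero
  | _, _, .succ => .lam (ap2 (.pair _ _) (.lam (.app .succ (.app (.app (.fst _ _) v1) v0)))
      (.app (.snd _ _) v0))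
  | _, _, .alpha => alphaTm σ
  | _, _, .recN => recNTm σ
  | _, _, .recA ρ => recATm σ ρ

end TmX

/-- Extensional agreement of the interpretation of `ρ°` with the semantics of `circ σ ρ`. -/
def CircRel (σ : FinType) : ∀ ρ : Ty, TyC σ.sem ρ → (circ σ ρ).sem → Prop
  | .nat, x, y => x = (show TyC σ.sem .nat from y)
  | .arr a b, f, g => ∀ u v, CircRel σ a u v → CircRel σ b (f u) (g v)

/-- `CircRel` extended to environments. -/
def CircRelEnv (σ : FinType) : ∀ Γ : List Ty, Env (TyC σ.sem) Γ →
    Env FinType.sem (Γ.map (circ σ)) → Prop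
  | [], _, _ => True
  | ρ :: Γ, e, e' => CircRel σ ρ e.1 e'.1 ∧ CircRelEnv σ Γ e.2 e'.2

lemma CircRelEnv.lookup {σ : FinType} : ∀ {Γ : List Ty} {ρ : Ty} (v : Idx Γ ρ)
    {e : Env (TyC σ.sem) Γ} {e' : Env FinType.sem (Γ.map (circ σ))}, CircRelEnv σ Γ e e' →
    CircRel σ ρ (v.lookup e) ((TmX.circIdx σ v).lookup e')
  | _, _, .zero, _, _, h => h.1
  | _, _, .succ v, _, _, h => CircRelEnv.lookup v h.2

lemma CircRel.natRec {σ : FinType} {ρ : Ty} {a : TyC σ.sem ρ} {a' : (circ σ ρ).sem}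
    {F : TyC σ.sem (.arr .nat (.arr ρ ρ))} {F' : (circ σ (.arr .nat (.arr ρ ρ))).sem}
    (ha : CircRel σ ρ a a') (hF : CircRel σ _ F F') (k : ℕ) :
    CircRel σ ρ (Nat.rec (motive := fun _ => TyC σ.sem ρ) a (fun k ih => F (kc σ.sem k) ih) k)
      (Nat.rec (motive := fun _ => (circ σ ρ).sem) a' (fun k ih => F' (kc σ.sem k) ih) k) := by
  induction k with
  | zero => exact ha
  | succ k ih => exact hF _ _ rfl _ _ ih

lemma CircRel.bind {σ : FinType} {Γ : List FinType} {e : Env FinType.sem Γ} {x y : TyC σ.sem .nat} {r q : ℕ → TyC σ.sem .nat}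
    (hx : CircRel σ .nat x y) (hr : ∀ k, CircRel σ .nat (r k) (q k)) :
    CircRel σ .nat
      ⟨fun α => (r (x.1 α)).1 α,
        fun G H s => x.2 (fun s' => (r (x.1 (ext 0 s'))).2 G H s') H s⟩
      ((TmX.bindTm σ).semX e q y) := by
  obtain rfl : x = y := hx
  obtain rfl : r = q := funext hr
  rfl

/-- The term `circTm σ t` denotes the interpretation of `t°`. -/
theorem circRel_csem {σ : FinType} : ∀ {Γ : List Ty} {ρ : Ty} (t : Tm .nat Γ ρ)
    {e : Env (TyC σ.sem) Γ} {e' : Env FinType.sem (Γ.map (circ σ))}, CircRelEnv σ Γ e e' →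
    CircRel σ ρ (t.csem σ.sem e) ((TmX.circTm σ t).semX e')
  | _, _, .var v, _, _, h => h.lookup v
  | _, _, .lam t, _, _, h => fun _ _ huv => circRel_csem t ⟨huv, h⟩
  | _, _, .app u v, _, _, h => circRel_csem u h _ _ (circRel_csem v h)
  | _, _, .zero, _, _, _ => rfl
  | _, _, .succ, _, _, _ => by rintro x y (rfl : x = y); rfl
  | _, _, .alpha, _, _, _ => by
      rintro x y (rfl : x = y)
      exact (congrFun (TmX.semX_alphaTm σ _) x).symm
  | _, _, .recN, _, _, _ => fun _ _ ha _ _ hF _ _ hx =>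
      CircRel.bind hx (CircRel.natRec (ρ := .nat) ha hF)
  | _, _, .recA ρ, _, _, _ => fun _ _ ha _ _ hF _ _ hx v v' hv =>
      CircRel.bind hx fun k => CircRel.natRec (ρ := .arr ρ .nat) ha hF k v v' hv

namespace TmX

variable {Γ : List FinType}

lemma inFragX_psiTm (σ : FinType) {j : ℕ} (hj : max 1 σ.level ≤ j) :
    (psiTm (Γ := Γ) σ).inFragX j := by
  simp only [psiTm, sub, inFragX, FinType.level, and_true, zero_le]; omega

lemma inFragX_phiTTm (σ : FinType) {j : ℕ} (hj : max 1 σ.level ≤ j) :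
    (phiTTm (Γ := Γ) σ).inFragX j := by
  have h := fun Γ => inFragX_psiTm (Γ := Γ) σ hj
  simp only [phiTTm, hdagTm, sub, extend, inFragX, FinType.level, h, true_and, and_true, zero_le]; omega

lemma inFragX_circTm (σ : FinType) {i : ℕ} : ∀ {Γ : List Ty} {ρ : Ty} (t : Tm .nat Γ ρ),
    t.inFrag i → (circTm σ t).inFragX (2 + max 1 σ.level + i)
  | _, _, .var _, _ => trivial
  | _, _, .lam t, h => inFragX_circTm σ t h
  | _, _, .app u v, h => ⟨inFragX_circTm σ u h.1, inFragX_circTm σ v h.2⟩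
  | _, _, .zero, _ => by simp [circTm, kcTm, inFragX]
  | _, _, .succ, _ => by simp [circTm, inFragX]
  | _, _, .alpha, _ => by
      have h := fun Γ => inFragX_psiTm (Γ := Γ) σ
        (show max 1 σ.level ≤ 2 + max 1 σ.level + i by omega)
      simp [circTm, alphaTm, extend, inFragX, h]
  | _, _, .recN, _ => by
      have h : (natCirc σ).level ≤ _ := level_circ_le σ .nat
      simp only [Ty.level] at h
      simp only [circTm, recNTm, bindTm, iterTm, kcTm, extend, inFragX, true_and, and_true]; omega
  | _, _, .recA ρ, h => by
      have h' := level_circ_le σ (.arr ρ .nat)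
      simp only [Tm.inFrag] at h
      simp only [circTm, recATm, bindTm, iterTm, kcTm, extend, inFragX, true_and, and_true]; omega

end TmX

end Definability

/-- The interpretation of `t°` for closed `t : ℕ`, at a fixed universe level. -/
def closedCirc (σ : FinType) (t : Tm .nat [] .nat) : TyC σ.sem .nat :=
  (TmX.circTm σ t).semX PUnit.unit.{1}

lemma csem_eq (σ : FinType) (t : Tm .nat [] .nat) :
    t.csem σ.sem PUnit.unit = closedCirc σ t :=
  circRel_csem t (e := PUnit.unit) (e' := PUnit.unit) trivial

lemma semX_circTm (σ : FinType) (t : Tm .nat [] .nat) :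
    (TmX.circTm σ t).semX PUnit.unit = closedCirc σ t :=
  (circRel_csem t (e := PUnit.unit.{1}) (e' := PUnit.unit) trivial).symm.trans (csem_eq σ t)

lemma sem_eq (σ : FinType) (t : Tm .nat [] .nat) :
    ((fun α => t.sem α PUnit.unit) : (ℕ → ℕ) → ℕ) = (closedCirc σ t).1 := by
  have h := barRel_csem (σS := σ.sem) t (e := fun _ => PUnit.unit)
    (e' := PUnit.unit.{1}) trivial
  rw [csem_eq] at h
  exact h.1.symm

/-- Corollary 3.4 (case `τ = ℕ`): for a System T term `t : ℕ` with only `α : ℕ → ℕ`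
free, `Φ^t(⟦B_{t°}⟧)` satisfies Spector's bar-recursion equation for
`Y = fun α => ⟦t⟧(α)`; moreover, if `t` lies in the fragment `T_i` then
`Φ^t(B_{t°})` is definable by a closed term of the fragment `T_j`,
where `j = 2 + max 1 (level σ) + i`. -/
theorem spector_T_definable (σ : FinType) (t : Tm .nat [] .nat) :
    SpectorBR (0 : ℕ) (fun α => t.sem α PUnit.unit)
      (PhiT (0 : ℕ) (fun α => t.sem α PUnit.unit) (t.csem σ.sem PUnit.unit).2) ∧
    ∀ i : ℕ, t.inFrag i →
      ∃ u : TmX [] (.arr (.arr (.star .nat) σ)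
          (.arr (.arr (.star .nat) (.arr (.arr .nat σ) σ)) (.arr (.star .nat) σ))),
        u.inFragX (2 + max 1 σ.level + i) ∧
        u.semX PUnit.unit =
          PhiT (0 : ℕ) (fun α => t.sem α PUnit.unit) (t.csem σ.sem PUnit.unit).2 := by
  simp only [sem_eq σ t, csem_eq σ t]
  obtain ⟨-, S, hS, hsec, hBR⟩ :=
    barRel_csem (σS := σ.sem) t (e := fun _ => PUnit.unit.{1}) (e' := PUnit.unit.{1}) trivial
  rw [csem_eq] at hsec hBR
  exact ⟨GenBR.spectorBR 0 hS hsec hBR, fun i hi =>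
    ⟨.app (TmX.phiTTm σ) (TmX.circTm σ t),
      ⟨TmX.inFragX_phiTTm σ (by omega), TmX.inFragX_circTm σ t hi⟩,
      (congrArg _ (semX_circTm σ t)).trans
        (congrFun (TmX.semX_phiTTm σ (Γ := []) PUnit.unit) (closedCirc σ t))⟩⟩
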